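/- arXiv:math/0608099 — 2 statements merged into one kernel-verified Lean document; each statement's English description precedes it below -/
import Mathlib

section
/- Let R be a commutative integral domain, G a group acting on R by ring automorphisms, and A = R#G the skew group ring. Let d : A → A be a derivation (an additive map with d(ab) = d(a)b + a·d(b)). Suppose g ∈ G acts nontrivially on R (i.e., there exists y ∈ R with g(y) ≠ y). Then for every x ∈ R with g(x) = x, the coefficient of δ_g in d(x·δ_1) is zero. -/
/-- The skew group ring `A = R#G`: its underlying additive group is the finitely
supported functions `G →₀ R` (so `r·δ_g` is `Finsupp.single g r`), with the
multiplication determined by `(r·δ_g)(s·δ_h) = (r · g(s))·δ_{g h}`, where the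
action of `G` on `R` by ring automorphisms is given by `ρ : G →* (R ≃+* R)`. -/
noncomputable def skewMul {R G : Type*} [CommRing R] [Group G]
    (ρ : G →* (R ≃+* R)) (f₁ f₂ : G →₀ R) : G →₀ R :=
  f₁.sum fun a r => f₂.sum fun b s => Finsupp.single (a * b) (r * ρ a s)

theorem skewMul_single_one_right_apply {R G : Type*} [CommRing R] [Group G]
    (ρ : G →* (R ≃+* R)) (f : G →₀ R) (y : R) (g : G) :
    skewMul ρ f (Finsupp.single 1 y) g = f g * ρ g y := by
  classical
  simp only [skewMul, map_zero, mul_zero, Finsupp.single_zero, Finsupp.sum_single_index,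
    mul_one]
  simp +contextual [Finsupp.sum, Finsupp.single_apply]

theorem skewMul_single_one_left_apply {R G : Type*} [CommRing R] [Group G]
    (ρ : G →* (R ≃+* R)) (f : G →₀ R) (y : R) (g : G) :
    skewMul ρ (Finsupp.single 1 y) f g = y * f g := by
  classical
  rw [skewMul, Finsupp.sum_single_index (by simp)]
  simp +contextual [Finsupp.sum, Finsupp.single_apply]

/-- Let `R` be a commutative integral domain, `G` a group acting
on `R` by ring automorphisms, and `A = R#G` the skew group ring. Let `d : A → A`
be a derivation (an additive map with `d (a*b) = d a * b + a * d b`). Suppose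
`g ∈ G` acts nontrivially on `R`. Then for every `x ∈ R` with `g x = x`, the
coefficient of `δ_g` in `d (x·δ_1)` is zero. -/
theorem stmt_1 {R G : Type*} [CommRing R] [IsDomain R] [Group G]
    (ρ : G →* (R ≃+* R)) (d : (G →₀ R) →+ (G →₀ R))
    (hd : ∀ a b : G →₀ R,
      d (skewMul ρ a b) = skewMul ρ (d a) b + skewMul ρ a (d b))
    (g : G) (hg : ∃ y : R, ρ g y ≠ y)
    (x : R) (hx : ρ g x = x) :
    d (Finsupp.single (1 : G) x) g = 0 := by
  obtain ⟨y, hy⟩ := hg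
  have hcomm : skewMul ρ (Finsupp.single 1 x) (Finsupp.single 1 y) =
      skewMul ρ (Finsupp.single 1 y) (Finsupp.single 1 x) := by
    simp [skewMul, mul_comm]
  have h := DFunLike.congr_fun (congrArg d hcomm) g
  simp only [hd, Finsupp.add_apply, skewMul_single_one_right_apply,
    skewMul_single_one_left_apply, hx] at h
  have hmul : d (Finsupp.single 1 x) g * (ρ g y - y) = 0 := by
    linear_combination h
  exact (mul_eq_zero.mp hmul).resolve_right (sub_ne_zero.mpr hy)
end

section
/- Let b, c, e be the ℂ-algebra automorphisms of ℂ[x1,x2,x3,x4] determined on the variables by b: (x1,x2,x3,x4) ↦ (−x1,−x2,x3,x4), c: (x1,x2,x3,x4) ↦ (x1,x2,−x3,−x4), e: (x1,x2,x3,x4) ↦ (x3,x4,x1,x2), and let G be the subgroup of algebra automorphisms generated by {b,c,e}. Then the subalgebra of polynomials fixed by every element of G equals the ℂ-subalgebra generated by the eight polynomials f1 = x1² + x3², f2 = x2² + x4², f3 = x1⁴ + x3⁴, f4 = x2⁴ + x4⁴, h1 = x1x2 + x3x4, h2 = x1²x2² + x3²x4², h3 = x1²x3x4 + x1x2x3²,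 h4 = x1x2x4² + x2²x3x4. -/
open MvPolynomial

/-- The ℂ-algebra involution of `ℂ[x₁,x₂,x₃,x₄]` determined on the variables by
`(x₁,x₂,x₃,x₄) ↦ (−x₁,−x₂,x₃,x₄)`. -/
noncomputable def bAut : MvPolynomial (Fin 4) ℂ ≃ₐ[ℂ] MvPolynomial (Fin 4) ℂ :=
  AlgEquiv.ofAlgHom (aeval ![-X 0, -X 1, X 2, X 3]) (aeval ![-X 0, -X 1, X 2, X 3])
    (by apply algHom_ext; intro i; fin_cases i <;> simp)
    (by apply algHom_ext; intro i; fin_cases i <;> simp)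

/-- The ℂ-algebra involution of `ℂ[x₁,x₂,x₃,x₄]` determined on the variables by
`(x₁,x₂,x₃,x₄) ↦ (x₁,x₂,−x₃,−x₄)`. -/
noncomputable def cAut : MvPolynomial (Fin 4) ℂ ≃ₐ[ℂ] MvPolynomial (Fin 4) ℂ :=
  AlgEquiv.ofAlgHom (aeval ![X 0, X 1, -X 2, -X 3]) (aeval ![X 0, X 1, -X 2, -X 3])
    (by apply algHom_ext; intro i; fin_cases i <;> simp)
    (by apply algHom_ext; intro i; fin_cases i <;> simp)

/-- The ℂ-algebra involution of `ℂ[x₁,x₂,x₃,x₄]` determined on the variables by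
`(x₁,x₂,x₃,x₄) ↦ (x₃,x₄,x₁,x₂)`. -/
noncomputable def eAut : MvPolynomial (Fin 4) ℂ ≃ₐ[ℂ] MvPolynomial (Fin 4) ℂ :=
  AlgEquiv.ofAlgHom (aeval ![X 2, X 3, X 0, X 1]) (aeval ![X 2, X 3, X 0, X 1])
    (by apply algHom_ext; intro i; fin_cases i <;> simp)
    (by apply algHom_ext; intro i; fin_cases i <;> simp)

lemma bAut_X (i : Fin 4) : bAut (X i) = ![-X 0, -X 1, X 2, X 3] i := by
  simp [bAut]

lemma cAut_X (i : Fin 4) : cAut (X i) = ![X 0, X 1, -X 2, -X 3] i := by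
  simp [cAut]

lemma eAut_X (i : Fin 4) : eAut (X i) = ![X 2, X 3, X 0, X 1] i := by
  simp [eAut]

lemma eAut_eAut (w : MvPolynomial (Fin 4) ℂ) : eAut (eAut w) = w :=
  eAut.left_inv w

/-- A monomial of even total degree in `x` and `y` is a product of copies of `x²`, `y²`, `xy`. -/
lemma pow_mul_pow_mem_closure {M : Type*} [CommMonoid M] (x y : M) {m n : ℕ}
    (h : Even (m + n)) :
    x ^ m * y ^ n ∈ Submonoid.closure ({x ^ 2, y ^ 2, x * y} : Set M) := by
  have hx : x ^ 2 ∈ Submonoid.closure ({x ^ 2, y ^ 2, x * y} : Set M) :=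
    Submonoid.subset_closure (by simp)
  have hy : y ^ 2 ∈ Submonoid.closure ({x ^ 2, y ^ 2, x * y} : Set M) :=
    Submonoid.subset_closure (by simp)
  have hxy : x * y ∈ Submonoid.closure ({x ^ 2, y ^ 2, x * y} : Set M) :=
    Submonoid.subset_closure (by simp)
  rcases Nat.even_or_odd' m with ⟨k, rfl | rfl⟩ <;>
    rcases Nat.even_or_odd' n with ⟨l, rfl | rfl⟩
  · rw [pow_mul, pow_mul]
    exact mul_mem (pow_mem hx k) (pow_mem hy l)
  · exact absurd h (by grind)
  · exact absurd h (by grind)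
  · rw [pow_succ x (2 * k), pow_succ y (2 * l), pow_mul, pow_mul, mul_mul_mul_comm]
    exact mul_mem (mul_mem (pow_mem hx k) (pow_mem hy l)) hxy

/-- A subalgebra containing the traces `s + σ s` and `s * t + σ (s * t)` of the generators `s, t`
of a monoid contains the traces of all elements of the monoid. -/
lemma add_map_mem_of_mem_closure {R : Type*} [CommRing R] [Algebra ℂ R] (σ : R →+* R)
    (S : Subalgebra ℂ R) (g : Set R) (h₁ : ∀ s ∈ g, s + σ s ∈ S)
    (h₂ : ∀ s ∈ g, ∀ t ∈ g, s * t + σ (s * t) ∈ S) {w : R} (hw : w ∈ Submonoid.closure g) :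
    w + σ w ∈ S := by
  have key : w + σ w ∈ S ∧ ∀ s ∈ g, s * w + σ (s * w) ∈ S := by
    induction hw using Submonoid.closure_induction_left with
    | one => exact ⟨by simpa using add_mem S.one_mem S.one_mem, by simpa using h₁⟩
    | mul_left t ht w hw ih =>
      refine ⟨ih.2 t ht, fun s hs => ?_⟩
      have hmem : (s + σ s) * (t * w + σ (t * w)) + (t + σ t) * (s * w + σ (s * w))
          + (w + σ w) * (s * t + σ (s * t)) - (s + σ s) * (t + σ t) * (w + σ w) ∈ S :=
        sub_mem (add_mem (add_mem (mul_mem (h₁ s hs) (ih.2 t ht)) (mul_mem (h₁ t ht) (ih.2 s hs)))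
          (mul_mem ih.1 (h₂ s hs t ht))) (mul_mem (mul_mem (h₁ s hs) (h₁ t ht)) ih.1)
      have heq : (s + σ s) * (t * w + σ (t * w)) + (t + σ t) * (s * w + σ (s * w))
          + (w + σ w) * (s * t + σ (s * t)) - (s + σ s) * (t + σ t) * (w + σ w)
          = (2 : ℂ) • (s * (t * w) + σ (s * (t * w))) := by
        rw [ofNat_smul_eq_nsmul ℂ 2, nsmul_eq_mul]
        simp only [map_mul]
        push_cast
        ring
      rw [heq] at hmem
      simpa using S.smul_mem hmem (2⁻¹ : ℂ)
  exact key.1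

/-- The eight basic invariants. -/
noncomputable def invariantGenerators : Set (MvPolynomial (Fin 4) ℂ) :=
  {X 0 ^ 2 + X 2 ^ 2, X 1 ^ 2 + X 3 ^ 2,
    X 0 ^ 4 + X 2 ^ 4, X 1 ^ 4 + X 3 ^ 4,
    X 0 * X 1 + X 2 * X 3,
    X 0 ^ 2 * X 1 ^ 2 + X 2 ^ 2 * X 3 ^ 2,
    X 0 ^ 2 * X 2 * X 3 + X 0 * X 1 * X 2 ^ 2,
    X 0 * X 1 * X 3 ^ 2 + X 1 ^ 2 * X 2 * X 3}

lemma map_eq_self_of_mem_adjoin {g : MvPolynomial (Fin 4) ℂ ≃ₐ[ℂ] MvPolynomial (Fin 4) ℂ}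
    (hg : g ∈ Subgroup.closure {bAut, cAut, eAut}) {φ : MvPolynomial (Fin 4) ℂ}
    (hφ : φ ∈ Algebra.adjoin ℂ invariantGenerators) : g φ = φ := by
  induction hg using Subgroup.closure_induction with
  | mem g hg =>
    have hle : Algebra.adjoin ℂ invariantGenerators
        ≤ AlgHom.equalizer (g : _ →ₐ[ℂ] _) (AlgHom.id ℂ _) := by
      refine Algebra.adjoin_le fun f hf => ?_
      simp only [invariantGenerators, Set.mem_insert_iff, Set.mem_singleton_iff] at hf
      rcases hg with rfl | rfl | rfl <;>
        rcases hf with rfl | rfl | rfl | rfl | rfl | rfl | rfl | rfl <;>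
        simp [bAut_X, cAut_X, eAut_X] <;> ring
    exact hle hφ
  | one => rfl
  | mul g h _ _ hg hh => rw [AlgEquiv.mul_apply, hh, hg]
  | inv g _ hg => exact (AlgEquiv.symm_apply_eq g).2 hg.symm

lemma add_eAut_mem_adjoin {w : MvPolynomial (Fin 4) ℂ}
    (hw : w ∈ Submonoid.closure {X 0 ^ 2, X 1 ^ 2, X 0 * X 1}) :
    w + eAut w ∈ Algebra.adjoin ℂ invariantGenerators := by
  have hgen : ∀ f ∈ invariantGenerators, f ∈ Algebra.adjoin ℂ invariantGenerators :=
    fun f hf => Algebra.subset_adjoin hf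
  simp only [invariantGenerators, Set.forall_mem_insert, Set.mem_singleton_iff,
    forall_eq] at hgen
  rw [← invariantGenerators] at hgen
  obtain ⟨f₁, f₂, f₃, f₄, h₁, h₂, h₃, h₄⟩ := hgen
  refine add_map_mem_of_mem_closure (eAut : _ →+* _) _ _ ?_ ?_ hw
  · simp only [Set.forall_mem_insert, Set.mem_singleton_iff, forall_eq]
    simp [eAut_X, f₁, f₂, h₁]
  · have h₃' := sub_mem (mul_mem f₁ h₁) h₃
    have h₄' := sub_mem (mul_mem f₂ h₁) h₄
    simp only [Set.forall_mem_insert, Set.mem_singleton_iff, forall_eq]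
    simp only [RingHom.coe_coe, map_mul, map_pow, eAut_X]
    refine ⟨⟨?_, ?_, ?_⟩, ⟨?_, ?_, ?_⟩, ?_, ?_, ?_⟩
    · convert f₃ using 1; simp; ring
    · convert h₂ using 1; simp
    · convert h₃' using 1; simp; ring
    · convert h₂ using 1; simp; ring
    · convert f₄ using 1; simp; ring
    · convert h₄' using 1; simp; ring
    · convert h₃' using 1; simp; ring
    · convert h₄' using 1; simp; ring
    · convert h₂ using 1; simp; ring

lemma mul_eAut_add_mem_adjoin {u v : MvPolynomial (Fin 4) ℂ}
    (hu : u ∈ Submonoid.closure {X 0 ^ 2, X 1 ^ 2, X 0 * X 1})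
    (hv : v ∈ Submonoid.closure {X 0 ^ 2, X 1 ^ 2, X 0 * X 1}) :
    u * eAut v + eAut (u * eAut v) ∈ Algebra.adjoin ℂ invariantGenerators := by
  have h := sub_mem (mul_mem (add_eAut_mem_adjoin hu) (add_eAut_mem_adjoin hv))
    (add_eAut_mem_adjoin (mul_mem hu hv))
  convert h using 1
  simp only [map_mul, eAut_eAut]
  ring

/-- The sum of the translates of a polynomial under the group generated by `b` and `c`. -/
noncomputable def signTrace : MvPolynomial (Fin 4) ℂ →ₗ[ℂ] MvPolynomial (Fin 4) ℂ :=
  LinearMap.id + bAut.toLinearMap + cAut.toLinearMap + bAut.toLinearMap ∘ₗ cAut.toLinearMap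

lemma signTrace_apply (φ : MvPolynomial (Fin 4) ℂ) :
    signTrace φ = φ + bAut φ + cAut φ + bAut (cAut φ) := rfl

lemma monomial_eq_mul_eAut (d : Fin 4 →₀ ℕ) (a : ℂ) :
    monomial d a = a • ((X 0 ^ d 0 * X 1 ^ d 1) * eAut (X 0 ^ d 2 * X 1 ^ d 3)) := by
  rw [monomial_eq, Finsupp.prod_fintype _ _ (by simp), Fin.prod_univ_four, smul_eq_C_mul]
  simp [eAut_X, mul_assoc]

lemma signTrace_monomial (d : Fin 4 →₀ ℕ) (a : ℂ) :
    signTrace (monomial d a)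
      = ((1 + (-1) ^ (d 0 + d 1)) * (1 + (-1) ^ (d 2 + d 3)) : ℂ) • monomial d a := by
  rw [monomial_eq_mul_eAut, signTrace_apply]
  simp only [map_smul]
  simp only [map_mul, map_pow, bAut_X, cAut_X, eAut_X, smul_eq_C_mul, map_add, map_one,
    map_neg, Matrix.cons_val]
  have hneg (i : Fin 4) (n : ℕ) :
      (-X i : MvPolynomial (Fin 4) ℂ) ^ n = (-1) ^ n * X i ^ n := neg_pow _ _
  simp only [hneg]
  ring

lemma signTrace_add_eAut_mem_adjoin (φ : MvPolynomial (Fin 4) ℂ) :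
    signTrace φ + eAut (signTrace φ) ∈ Algebra.adjoin ℂ invariantGenerators := by
  induction φ using MvPolynomial.induction_on' with
  | monomial d a =>
    rw [signTrace_monomial]
    rcases Nat.even_or_odd (d 0 + d 1) with h₀ | h₀
    · rcases Nat.even_or_odd (d 2 + d 3) with h₂ | h₂
      · rw [monomial_eq_mul_eAut, smul_smul, map_smul, ← smul_add]
        exact Subalgebra.smul_mem _ (mul_eAut_add_mem_adjoin
          (pow_mul_pow_mem_closure _ _ h₀) (pow_mul_pow_mem_closure _ _ h₂)) _
      · simp [h₂.neg_one_pow]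
    · simp [h₀.neg_one_pow]
  | add p q hp hq =>
    rw [map_add, map_add, add_add_add_comm]
    exact add_mem hp hq

/-- Let `G` be the subgroup of ℂ-algebra automorphisms of
`ℂ[x₁,x₂,x₃,x₄]` generated by `b, c, e`.  The subalgebra of polynomials fixed by
every element of `G` equals the ℂ-subalgebra generated by the eight polynomials
`f₁ = x₁² + x₃²`, `f₂ = x₂² + x₄²`, `f₃ = x₁⁴ + x₃⁴`, `f₄ = x₂⁴ + x₄⁴`,
`h₁ = x₁x₂ + x₃x₄`, `h₂ = x₁²x₂² + x₃²x₄²`, `h₃ = x₁²x₃x₄ + x₁x₂x₃²`,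
`h₄ = x₁x₂x₄² + x₂²x₃x₄`. -/
theorem stmt_5 (φ : MvPolynomial (Fin 4) ℂ) :
    (∀ g ∈ Subgroup.closure {bAut, cAut, eAut}, g φ = φ) ↔
      φ ∈ Algebra.adjoin ℂ
        ({X 0 ^ 2 + X 2 ^ 2, X 1 ^ 2 + X 3 ^ 2,
          X 0 ^ 4 + X 2 ^ 4, X 1 ^ 4 + X 3 ^ 4,
          X 0 * X 1 + X 2 * X 3,
          X 0 ^ 2 * X 1 ^ 2 + X 2 ^ 2 * X 3 ^ 2,
          X 0 ^ 2 * X 2 * X 3 + X 0 * X 1 * X 2 ^ 2,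
          X 0 * X 1 * X 3 ^ 2 + X 1 ^ 2 * X 2 * X 3} :
          Set (MvPolynomial (Fin 4) ℂ)) := by
  rw [← invariantGenerators]
  refine ⟨fun h => ?_, fun hφ g hg => map_eq_self_of_mem_adjoin hg hφ⟩
  have hb : bAut φ = φ := h _ (Subgroup.subset_closure (by simp))
  have hc : cAut φ = φ := h _ (Subgroup.subset_closure (by simp))
  have he : eAut φ = φ := h _ (Subgroup.subset_closure (by simp))
  have hmem := signTrace_add_eAut_mem_adjoin φ
  have heq : signTrace φ + eAut (signTrace φ) = (8 : ℂ) • φ := by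
    simp only [signTrace_apply, hb, hc, he, map_add]
    module
  rw [heq] at hmem
  simpa using Subalgebra.smul_mem _ hmem (8⁻¹ : ℂ)
end
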